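/- Let ι₁ and ι₂ be nonempty finite index sets and let ρ be a density matrix on ℂ^{ι₁×ι₂}. Define its marginals ρ₁(a,a') = ∑_{b∈ι₂} ρ((a,b),(a',b)) and ρ₂(b,b') = ∑_{a∈ι₁} ρ((a,b),(a,b')), and set σ := ρ₁ ⊗ ρ₂ (Kronecker product). Let ℰ_σ be the pinching map with respect to σ and ν₁ the number of distinct eigenvalues of σ. Fix reals R, R_S > 0 and α ∈ (0, 1/2). Let Π := ∑_{λ ≥ 0} P_λ be the spectral projection onto the nonnegative eigenvalues of the Hermitian matrix ℰ_σ(ρ) − 2^{R+R_S}·σ = ∑_λ λ P_λ. Then 2^{R+R_S} · Tr[Π σ] ≤ ν₁^α · 2^{α(R+R_S)} · Tr[(σ^{α/(2(1−α))} ρ σ^{α/(2(1−α))})^{1−α}], i.e. 2^{R+R_S} Tr[Π σ] ≤ ν₁^α · 2^{α[R + R_S − D̃_{1−α}(ρ‖σ)]}. -/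

import Mathlib

open Matrix BigOperators
open scoped ComplexOrder

noncomputable section

variable {n : Type*} [Fintype n] [DecidableEq n]

/-- Real power with the convention `0 ^ r = 0`. -/
def rpow0 (x r : ℝ) : ℝ := if x = 0 then 0 else Real.rpow x r

/-- Matrix power by the spectral functional calculus (with `0 ^ r = 0` on the kernel),
for Hermitian matrices; junk value `0` otherwise. -/
def matPow (M : Matrix n n ℂ) (r : ℝ) : Matrix n n ℂ :=
  if h : M.IsHermitian then
    (h.eigenvectorUnitary : Matrix n n ℂ) *
      Matrix.diagonal (fun i => (rpow0 (h.eigenvalues i) r : ℂ)) *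
      star (h.eigenvectorUnitary : Matrix n n ℂ)
  else 0

/-- A density matrix: positive semidefinite with unit trace. -/
def IsDensityMatrix (M : Matrix n n ℂ) : Prop := M.PosSemidef ∧ M.trace = 1

/-- Number of distinct eigenvalues of a Hermitian matrix (junk value `0` otherwise). -/
def nEig (M : Matrix n n ℂ) : ℕ :=
  if h : M.IsHermitian then (Finset.univ.image h.eigenvalues).card else 0

/-- The spectral projection of a Hermitian matrix onto the eigenspace of `t`. -/
def spectralProj (M : Matrix n n ℂ) (h : M.IsHermitian) (t : ℝ) : Matrix n n ℂ :=
  (h.eigenvectorUnitary : Matrix n n ℂ) *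
    Matrix.diagonal (fun i => if h.eigenvalues i = t then (1 : ℂ) else 0) *
    star (h.eigenvectorUnitary : Matrix n n ℂ)

/-- The pinching map with respect to a Hermitian matrix `A`:
`ℰ_A(B) = ∑_λ P_λ B P_λ` over the distinct eigenvalues `λ` of `A`. -/
def pinch (A B : Matrix n n ℂ) : Matrix n n ℂ :=
  if h : A.IsHermitian then
    ∑ t ∈ Finset.univ.image h.eigenvalues,
      spectralProj A h t * B * spectralProj A h t
  else B

/-- The spectral projection of a Hermitian matrix onto its nonnegative eigenvalues,
`Π = ∑_{λ ≥ 0} P_λ` (junk value `0` for non-Hermitian matrices). -/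
def posProj (M : Matrix n n ℂ) : Matrix n n ℂ :=
  if h : M.IsHermitian then
    (h.eigenvectorUnitary : Matrix n n ℂ) *
      Matrix.diagonal (fun i => if 0 ≤ h.eigenvalues i then (1 : ℂ) else 0) *
      star (h.eigenvectorUnitary : Matrix n n ℂ)
  else 0

/-- The sandwiched Rényi divergence
`D̃_α(ρ‖σ) = (1/(α−1)) log₂ Tr[(σ^{(1−α)/(2α)} ρ σ^{(1−α)/(2α)})^α]`. -/
def sandwichedRenyi (α : ℝ) (ρ σ : Matrix n n ℂ) : ℝ :=
  (1 / (α - 1)) *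
    Real.logb 2
      ((matPow (matPow σ ((1 - α) / (2 * α)) * ρ * matPow σ ((1 - α) / (2 * α))) α).trace.re)

/-- Fidelity `F(ρ,σ) = Tr[(σ^{1/2} ρ σ^{1/2})^{1/2}]`. -/
def fidelity (ρ σ : Matrix n n ℂ) : ℝ :=
  (matPow (matPow σ (1/2) * ρ * matPow σ (1/2)) (1/2)).trace.re

/-- Purified distance `P(ρ,σ) = √(1 − F(ρ,σ)²)`. -/
def purifiedDist (ρ σ : Matrix n n ℂ) : ℝ :=
  Real.sqrt (1 - (fidelity ρ σ) ^ 2)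

/-- Base-two matrix logarithm by spectral functional calculus (`0 ↦ 0` on the kernel). -/
def matLog2 (M : Matrix n n ℂ) : Matrix n n ℂ :=
  if h : M.IsHermitian then
    (h.eigenvectorUnitary : Matrix n n ℂ) *
      Matrix.diagonal (fun i => (Real.logb 2 (h.eigenvalues i) : ℂ)) *
      star (h.eigenvectorUnitary : Matrix n n ℂ)
  else 0

/-- Quantum relative entropy `D(ρ‖σ) = Tr[ρ (log₂ ρ − log₂ σ)]`. -/
def relEntropy (ρ σ : Matrix n n ℂ) : ℝ :=
  (ρ * (matLog2 ρ - matLog2 σ)).trace.re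


end

lemma LinearMap.IsSymmetric.exists_orthonormalBasis_of_commute {n E : Type*} [Fintype n]
    [NormedAddCommGroup E]
    [InnerProductSpace ℂ E] [FiniteDimensional ℂ E] {S T : E →ₗ[ℂ] E} (hS : S.IsSymmetric)
    (hT : T.IsSymmetric) (h : Commute S T) (hn : Module.finrank ℂ E = Fintype.card n) :
    ∃ (b : OrthonormalBasis n ℂ E) (s t : n → ℝ),
      (∀ j, S (b j) = (s j : ℂ) • b j) ∧ ∀ j, T (b j) = (t j : ℂ) • b j := by
  classical
  have hmaps (μ : Module.End.Eigenvalues S) :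
      ∀ v ∈ Module.End.eigenspace S μ, T v ∈ Module.End.eigenspace S μ :=
    fun v hv => Module.End.mapsTo_genEigenspace_of_comm h μ 1 hv
  have hsymm (μ : Module.End.Eigenvalues S) := hT.restrict_invariant (hmaps μ)
  let v (μ : Module.End.Eigenvalues S) := (hsymm μ).eigenvectorBasis rfl
  let b := hS.direct_sum_isInternal.collectedOrthonormalBasis hS.orthogonalFamily_eigenspaces' v
  have hb (k) : b k = (v k.1 k.2 : E) := by
    simp [b, DirectSum.IsInternal.collectedOrthonormalBasis]
  let e := Fintype.equivOfCardEq ((Module.finrank_eq_card_basis b.toBasis).symm.trans hn)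
  refine ⟨b.reindex e, fun j => ((e.symm j).1 : ℂ).re,
    fun j => (hsymm (e.symm j).1).eigenvalues rfl (e.symm j).2, fun j => ?_, fun j => ?_⟩
  · have hmem := (v (e.symm j).1 (e.symm j).2).2
    rw [← hb, Module.End.mem_eigenspace_iff] at hmem
    have hre : ((((e.symm j).1 : ℂ).re : ℝ) : ℂ) = ((e.symm j).1 : ℂ) :=
      Complex.conj_eq_iff_re.mp (hS.conj_eigenvalue_eq_self (e.symm j).1.2)
    rw [OrthonormalBasis.reindex_apply, hre]
    exact hmem
  · have hv := congrArg Subtype.val ((hsymm (e.symm j).1).apply_eigenvectorBasis rfl (e.symm j).2)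
    rw [OrthonormalBasis.reindex_apply, hb]
    exact hv

section JointDiagonalization

variable {n : Type*} [Fintype n] [DecidableEq n]

lemma Matrix.IsHermitian.exists_unitary_of_commute {A B : Matrix n n ℂ} (hA : A.IsHermitian)
    (hB : B.IsHermitian) (h : Commute A B) :
    ∃ U ∈ unitaryGroup n ℂ, ∃ a b : n → ℝ,
      A = U * diagonal (fun i => (a i : ℂ)) * star U ∧
      B = U * diagonal (fun i => (b i : ℂ)) * star U := by
  obtain ⟨v, a, b, ha, hb⟩ :=
    (isSymmetric_toEuclideanLin_iff.mpr hA).exists_orthonormalBasis_of_commute (n := n)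
      (isSymmetric_toEuclideanLin_iff.mpr hB)
      (by
        refine LinearMap.ext fun x => ?_
        simp [Matrix.toLpLin_apply, mulVec_mulVec, h.eq]) finrank_euclideanSpace
  let U := (EuclideanSpace.basisFun n ℂ).toBasis.toMatrix v
  have hU : U ∈ unitaryGroup n ℂ :=
    (EuclideanSpace.basisFun n ℂ).toMatrix_orthonormalBasis_mem_unitary v
  have key {C : Matrix n n ℂ} {c : n → ℝ}
      (hc : ∀ j, toEuclideanLin C (v j) = (c j : ℂ) • v j) :
      C = U * diagonal (fun i => (c i : ℂ)) * star U := by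
    have hCU : C * U = U * diagonal (fun i => (c i : ℂ)) := by
      ext i j
      have := congrArg (fun x : EuclideanSpace ℂ n => x i) (hc j)
      rw [mul_diagonal, mul_comm]
      exact this
    rw [← hCU, mul_assoc, mem_unitaryGroup_iff.mp hU, mul_one]
  exact ⟨U, hU, a, b, key ha, key hb⟩

lemma star_mul_intertwines {U V : Matrix n n ℂ} (hU : U ∈ unitaryGroup n ℂ)
    (hV : V ∈ unitaryGroup n ℂ) {a b : n → ℝ}
    (h : U * diagonal (fun i => (a i : ℂ)) * star U =
      V * diagonal (fun i => (b i : ℂ)) * star V) (i j : n) :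
    (star V * U) i j = 0 ∨ a j = b i := by
  have h1 : star V * U * diagonal (fun i => (a i : ℂ)) =
      diagonal (fun i => (b i : ℂ)) * (star V * U) := by
    calc star V * U * diagonal (fun i => (a i : ℂ))
        = star V * (U * diagonal (fun i => (a i : ℂ)) * star U) * U := by
          simp only [mul_assoc, mem_unitaryGroup_iff'.mp hU, mul_one]
      _ = (star V * V) * diagonal (fun i => (b i : ℂ)) * (star V * U) := by
          rw [h]; simp only [mul_assoc]
      _ = _ := by rw [mem_unitaryGroup_iff'.mp hV, one_mul]
  have h2 := congrFun (congrFun h1 i) j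
  rw [mul_diagonal, diagonal_mul, mul_comm] at h2
  by_cases hz : (star V * U) i j = 0
  · exact Or.inl hz
  · exact Or.inr (by exact_mod_cast mul_right_cancel₀ hz h2)

/-- The spectral functional calculus does not depend on the diagonalization. -/
lemma conj_diagonal_congr {U V : Matrix n n ℂ} (hU : U ∈ unitaryGroup n ℂ)
    (hV : V ∈ unitaryGroup n ℂ) {a b : n → ℝ}
    (h : U * diagonal (fun i => (a i : ℂ)) * star U =
      V * diagonal (fun i => (b i : ℂ)) * star V) (f : ℝ → ℂ) :
    U * diagonal (fun i => f (a i)) * star U = V * diagonal (fun i => f (b i)) * star V := by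
  have h1 : star V * U * diagonal (fun i => f (a i)) =
      diagonal (fun i => f (b i)) * (star V * U) := by
    ext i j
    rw [mul_diagonal, diagonal_mul]
    rcases star_mul_intertwines hU hV h i j with h0 | h0
    · simp [h0]
    · rw [h0, mul_comm]
  calc U * diagonal (fun i => f (a i)) * star U
      = (V * star V) * U * diagonal (fun i => f (a i)) * star U := by
        rw [mem_unitaryGroup_iff.mp hV, one_mul]
    _ = V * (star V * U * diagonal (fun i => f (a i))) * star U := by simp only [mul_assoc]
    _ = V * diagonal (fun i => f (b i)) * star V * (U * star U) := by
        rw [h1]; simp only [mul_assoc]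
    _ = _ := by rw [mem_unitaryGroup_iff.mp hU, mul_one]

lemma range_subset_of_conj_diagonal_eq {U V : Matrix n n ℂ} (hU : U ∈ unitaryGroup n ℂ)
    (hV : V ∈ unitaryGroup n ℂ) {a b : n → ℝ}
    (h : U * diagonal (fun i => (a i : ℂ)) * star U =
      V * diagonal (fun i => (b i : ℂ)) * star V) (j : n) : ∃ i, b i = a j := by
  by_contra! hne
  have hz (i : n) : (star V * U) i j = 0 :=
    (star_mul_intertwines hU hV h i j).resolve_right (hne i).symm
  have hcol (i : n) : U i j = 0 := by
    have : (V * (star V * U)) i j = U i j := by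
      rw [← mul_assoc, mem_unitaryGroup_iff.mp hV, one_mul]
    rw [← this, mul_apply]
    simp [hz]
  have h2 := congrFun (congrFun (mem_unitaryGroup_iff'.mp hU) j) j
  rw [mul_apply] at h2
  simp [hcol] at h2

lemma Matrix.IsHermitian.eq_conj_diagonal {A : Matrix n n ℂ} (hA : A.IsHermitian) :
    A = (hA.eigenvectorUnitary : Matrix n n ℂ) * diagonal (fun i => (hA.eigenvalues i : ℂ)) *
      star (hA.eigenvectorUnitary : Matrix n n ℂ) := by
  have := hA.spectral_theorem
  rwa [Unitary.conjStarAlgAut_apply] at this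

variable {U : Matrix n n ℂ} {a : n → ℝ}

lemma isHermitian_conj_diagonal : (U * diagonal (fun i => (a i : ℂ)) * star U).IsHermitian := by
  rw [star_eq_conjTranspose]
  exact isHermitian_mul_mul_conjTranspose _
    (isHermitian_diagonal_of_self_adjoint _ (by ext; simp))

lemma matPow_conj_diagonal (hU : U ∈ unitaryGroup n ℂ) (r : ℝ) :
    matPow (U * diagonal (fun i => (a i : ℂ)) * star U) r =
      U * diagonal (fun i => (rpow0 (a i) r : ℂ)) * star U := by
  have h : (U * diagonal (fun i => (a i : ℂ)) * star U).IsHermitian := isHermitian_conj_diagonal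
  rw [matPow, dif_pos h]
  exact conj_diagonal_congr h.eigenvectorUnitary.2 hU h.eq_conj_diagonal.symm
    (fun x => (rpow0 x r : ℂ))

lemma posProj_conj_diagonal (hU : U ∈ unitaryGroup n ℂ) :
    posProj (U * diagonal (fun i => (a i : ℂ)) * star U) =
      U * diagonal (fun i => if 0 ≤ a i then (1 : ℂ) else 0) * star U := by
  have h : (U * diagonal (fun i => (a i : ℂ)) * star U).IsHermitian := isHermitian_conj_diagonal
  rw [posProj, dif_pos h]
  exact conj_diagonal_congr h.eigenvectorUnitary.2 hU h.eq_conj_diagonal.symm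
    (fun x => if 0 ≤ x then (1 : ℂ) else 0)

lemma card_image_le_nEig (hU : U ∈ unitaryGroup n ℂ) :
    (Finset.univ.image a).card ≤ nEig (U * diagonal (fun i => (a i : ℂ)) * star U) := by
  have h : (U * diagonal (fun i => (a i : ℂ)) * star U).IsHermitian := isHermitian_conj_diagonal
  rw [nEig, dif_pos h]
  refine Finset.card_le_card fun x hx => ?_
  obtain ⟨j, -, rfl⟩ := Finset.mem_image.mp hx
  obtain ⟨i, hi⟩ := range_subset_of_conj_diagonal_eq hU h.eigenvectorUnitary.2
    h.eq_conj_diagonal j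
  exact Finset.mem_image.mpr ⟨i, Finset.mem_univ i, hi⟩

/-- In an eigenbasis of `A`, pinching keeps the entries between equal eigenvalues of `A` and
deletes the others. -/
lemma star_mul_pinch_mul (hU : U ∈ unitaryGroup n ℂ) (B : Matrix n n ℂ) (j k : n) :
    (star U * pinch (U * diagonal (fun i => (a i : ℂ)) * star U) B * U) j k =
      if a j = a k then (star U * B * U) j k else 0 := by
  have h : (U * diagonal (fun i => (a i : ℂ)) * star U).IsHermitian := isHermitian_conj_diagonal
  have hproj (t : ℝ) : spectralProj _ h t =
      U * diagonal (fun i => if a i = t then (1 : ℂ) else 0) * star U :=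
    conj_diagonal_congr h.eigenvectorUnitary.2 hU h.eq_conj_diagonal.symm
      (fun x => if x = t then (1 : ℂ) else 0)
  have hterm (t : ℝ) : (star U * (spectralProj _ h t * B * spectralProj _ h t) * U) j k =
      (if a j = t then 1 else 0) * (star U * B * U) j k * (if a k = t then 1 else 0) := by
    rw [hproj]
    trans (diagonal (fun i => if a i = t then (1 : ℂ) else 0) * (star U * B * U) *
      diagonal (fun i => if a i = t then (1 : ℂ) else 0)) j k
    swap
    · rw [mul_diagonal, diagonal_mul]
    refine congrFun (congrFun ?_ j) k
    calc _ = (star U * U) * diagonal (fun i => if a i = t then (1 : ℂ) else 0) *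
          (star U * B * U) * diagonal (fun i => if a i = t then (1 : ℂ) else 0) *
          (star U * U) := by simp only [mul_assoc]
      _ = _ := by simp only [mem_unitaryGroup_iff'.mp hU, one_mul, mul_one]
  rw [pinch, dif_pos h, Finset.mul_sum, Finset.sum_mul, Matrix.sum_apply,
    Finset.sum_congr rfl fun t _ => hterm t]
  split_ifs with hjk
  · rw [Finset.sum_eq_single (a j)]
    · simp [hjk]
    · intro t _ ht
      simp [Ne.symm ht]
    · intro hj
      obtain ⟨i, hi⟩ := range_subset_of_conj_diagonal_eq hU h.eigenvectorUnitary.2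
        h.eq_conj_diagonal j
      exact absurd (Finset.mem_image.mpr ⟨i, Finset.mem_univ i, hi⟩) hj
  · refine Finset.sum_eq_zero fun t _ => ?_
    by_cases h1 : a j = t
    · have h2 : a k ≠ t := fun h2 => hjk (h1.trans h2.symm)
      simp [h2]
    · simp [h1]

lemma commute_pinch_conj_diagonal (hU : U ∈ unitaryGroup n ℂ) (B : Matrix n n ℂ) :
    Commute (U * diagonal (fun i => (a i : ℂ)) * star U)
      (pinch (U * diagonal (fun i => (a i : ℂ)) * star U) B) := by
  set P := pinch (U * diagonal (fun i => (a i : ℂ)) * star U) B with hP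
  have hcomm : diagonal (fun i => (a i : ℂ)) * (star U * P * U) =
      (star U * P * U) * diagonal (fun i => (a i : ℂ)) := by
    ext j k
    rw [diagonal_mul, mul_diagonal, hP, star_mul_pinch_mul hU]
    split_ifs with hjk
    · rw [hjk, mul_comm]
    · simp
  calc U * diagonal (fun i => (a i : ℂ)) * star U * P
      = U * (diagonal (fun i => (a i : ℂ)) * (star U * P * U)) * star U := by
        simp only [mul_assoc, mem_unitaryGroup_iff.mp hU, mul_one]
    _ = (U * star U) * P * U * diagonal (fun i => (a i : ℂ)) * star U := by
        rw [hcomm]; simp only [mul_assoc]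
    _ = P * (U * diagonal (fun i => (a i : ℂ)) * star U) := by
        rw [mem_unitaryGroup_iff.mp hU, one_mul]; simp only [mul_assoc]

lemma commute_pinch {A : Matrix n n ℂ} (hA : A.IsHermitian) (B : Matrix n n ℂ) :
    Commute A (pinch A B) := by
  rw [hA.eq_conj_diagonal]
  exact commute_pinch_conj_diagonal hA.eigenvectorUnitary.2 B

lemma isHermitian_pinch (A : Matrix n n ℂ) {B : Matrix n n ℂ} (hB : B.IsHermitian) :
    (pinch A B).IsHermitian := by
  rw [pinch]
  split_ifs with h
  · rw [IsHermitian, conjTranspose_sum]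
    refine Finset.sum_congr rfl fun t _ => ?_
    have hp : (spectralProj A h t)ᴴ = spectralProj A h t := by
      have hd : star (fun i => if h.eigenvalues i = t then (1 : ℂ) else 0) =
          fun i => if h.eigenvalues i = t then (1 : ℂ) else 0 := by
        ext i
        by_cases hi : h.eigenvalues i = t <;> simp [hi]
      simp only [spectralProj, star_eq_conjTranspose, conjTranspose_mul, diagonal_conjTranspose,
        conjTranspose_conjTranspose, hd, mul_assoc]
    rw [conjTranspose_mul, conjTranspose_mul, hp, hB.eq, mul_assoc]
  · exact hB

lemma trace_conj_diagonal (hU : U ∈ unitaryGroup n ℂ) (d : n → ℂ) :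
    (U * diagonal d * star U).trace = ∑ i, d i := by
  rw [trace_mul_comm, ← mul_assoc, mem_unitaryGroup_iff'.mp hU, one_mul, trace_diagonal]

end JointDiagonalization

lemma rpow0_eq_rpow {x r : ℝ} (hr : 0 < r) : rpow0 x r = x ^ r := by
  rw [rpow0]
  split_ifs with h
  · rw [h, Real.zero_rpow hr.ne']
  · rfl

section PinchedTrace

variable {n : Type*} [Fintype n] [DecidableEq n]

/-- Bessel inequality for a family orthogonal with respect to the form `diagonal x`. -/
lemma mul_sum_normSq_div_le_one {W : Matrix n n ℂ} {x y : n → ℝ} (hx : ∀ i, 0 ≤ x i)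
    (s : Finset n)
    (h : ∀ j ∈ s, ∀ k ∈ s, ∑ i, W j i * x i * star (W k i) = if j = k then (y j : ℂ) else 0)
    (i : n) : ∑ j ∈ s, x i * Complex.normSq (W j i) / y j ≤ 1 := by
  set S := ∑ j ∈ s, Complex.normSq (W j i) / y j with hS
  let b (l : n) : ℂ := ∑ j ∈ s, star (W j i) / y j * W j l
  have hbi : b i = S := by
    rw [hS, Complex.ofReal_sum]
    refine Finset.sum_congr rfl fun j _ => ?_
    rw [Complex.ofReal_div, Complex.normSq_eq_conj_mul_self, Complex.star_def]
    ring
  have hsum : ∑ l, x l * Complex.normSq (b l) = S := by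
    have : ∑ l, (x l : ℂ) * (b l * star (b l)) = S := by
      calc ∑ l, (x l : ℂ) * (b l * star (b l))
          = ∑ l, ∑ j ∈ s, ∑ k ∈ s, star (W j i) / y j * (W k i / y k) *
              (W j l * x l * star (W k l)) := by
            refine Finset.sum_congr rfl fun l _ => ?_
            simp only [b, star_sum]
            rw [Finset.sum_mul_sum]
            simp only [Finset.mul_sum]
            refine Finset.sum_congr rfl fun j _ => Finset.sum_congr rfl fun k _ => ?_
            simp only [star_mul', star_div₀, Complex.star_def, Complex.conj_ofReal, Complex.conj_conj]
            ring
        _ = ∑ j ∈ s, ∑ k ∈ s, star (W j i) / y j * (W k i / y k) *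
              ∑ l, W j l * x l * star (W k l) := by
            rw [Finset.sum_comm]
            refine Finset.sum_congr rfl fun j _ => ?_
            rw [Finset.sum_comm]
            simp only [Finset.mul_sum]
        _ = ∑ j ∈ s, ((Complex.normSq (W j i) / y j : ℝ) : ℂ) := by
            refine Finset.sum_congr rfl fun j hj => ?_
            rw [Finset.sum_congr rfl fun k hk => by rw [h j hj k hk]]
            simp only [mul_ite, mul_zero, Finset.sum_ite_eq, hj, if_true]
            rw [Complex.ofReal_div, Complex.normSq_eq_conj_mul_self, Complex.star_def]
            rcases eq_or_ne (y j : ℂ) 0 with hy | hy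
            · simp [hy]
            · field_simp
        _ = S := by rw [hS, Complex.ofReal_sum]
    have h2 : ((∑ l, x l * Complex.normSq (b l) : ℝ) : ℂ) = S := by
      rw [← this, Complex.ofReal_sum]
      refine Finset.sum_congr rfl fun l _ => ?_
      rw [Complex.ofReal_mul, Complex.star_def, Complex.mul_conj]
    exact_mod_cast h2
  have hle : x i * S ^ 2 ≤ S := by
    calc x i * S ^ 2 = x i * Complex.normSq (b i) := by
          rw [hbi, Complex.normSq_ofReal, sq]
      _ ≤ ∑ l, x l * Complex.normSq (b l) :=
          Finset.single_le_sum (f := fun l => x l * Complex.normSq (b l))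
            (fun l _ => mul_nonneg (hx l) (Complex.normSq_nonneg _)) (Finset.mem_univ i)
      _ = S := hsum
  have heq : ∑ j ∈ s, x i * Complex.normSq (W j i) / y j = x i * S := by
    rw [hS, Finset.mul_sum]
    exact Finset.sum_congr rfl fun j _ => mul_div_assoc _ _ _
  rw [heq]
  by_contra! hlt
  have hSpos : 0 < S := by
    by_contra! hS0
    nlinarith [hx i]
  nlinarith

/-- If `y` is the spectrum of the pinching of a positive matrix with spectrum `x`, with `ν` blocks
labelled by the values of `c`, then `∑ y ^ p ≤ ν ^ (1 - p) * ∑ x ^ p` for `0 < p ≤ 1`. -/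
lemma sum_rpow_le_card_rpow_mul_sum_rpow {W : Matrix n n ℂ} (hW : W ∈ unitaryGroup n ℂ)
    {x y c : n → ℝ} (hx : ∀ i, 0 ≤ x i)
    (h : ∀ j k, c j = c k → ∑ i, W j i * x i * star (W k i) = if j = k then (y j : ℂ) else 0)
    {p : ℝ} (hp : 0 < p) (hp1 : p ≤ 1) :
    ∑ j, y j ^ p ≤ ((Finset.univ.image c).card : ℝ) ^ (1 - p) * ∑ i, x i ^ p := by
  have hydef (j : n) : y j = ∑ i, x i * Complex.normSq (W j i) := by
    have := h j j rfl
    rw [if_pos rfl] at this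
    have h2 : ((∑ i, x i * Complex.normSq (W j i) : ℝ) : ℂ) = y j := by
      rw [← this, Complex.ofReal_sum]
      refine Finset.sum_congr rfl fun l _ => ?_
      rw [Complex.ofReal_mul, Complex.star_def, ← Complex.mul_conj]
      ring
    exact_mod_cast h2.symm
  have hy (j : n) : 0 ≤ y j := by
    rw [hydef]
    exact Finset.sum_nonneg fun i _ => mul_nonneg (hx i) (Complex.normSq_nonneg _)
  let q (i j : n) : ℝ := x i * Complex.normSq (W j i) / y j
  have hq (i j : n) : 0 ≤ q i j :=
    div_nonneg (mul_nonneg (hx i) (Complex.normSq_nonneg _)) (hy j)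
  have hqsum (i : n) : ∑ j, q i j ≤ (Finset.univ.image c).card := by
    rw [← Finset.sum_fiberwise_of_maps_to (g := c) (t := Finset.univ.image c)
      (fun j hj => Finset.mem_image_of_mem c hj), Finset.card_eq_sum_ones, Nat.cast_sum]
    refine Finset.sum_le_sum fun t _ => ?_
    rw [Nat.cast_one]
    refine mul_sum_normSq_div_le_one hx _ (fun j hj k hk => h j k ?_) i
    rw [(Finset.mem_filter.mp hj).2, (Finset.mem_filter.mp hk).2]
  have hqy (i : n) : ∑ j, q i j * y j ≤ x i := by
    have hnorm : ∑ j, Complex.normSq (W j i) = 1 := by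
      have h1 := congrFun (congrFun (mem_unitaryGroup_iff'.mp hW) i) i
      rw [mul_apply, one_apply_eq] at h1
      have h2 : ((∑ j, Complex.normSq (W j i) : ℝ) : ℂ) = 1 := by
        rw [← h1, Complex.ofReal_sum]
        refine Finset.sum_congr rfl fun j _ => ?_
        rw [Complex.normSq_eq_conj_mul_self, star_apply, Complex.star_def]
      exact_mod_cast h2
    calc ∑ j, q i j * y j ≤ ∑ j, x i * Complex.normSq (W j i) :=
          Finset.sum_le_sum fun j _ => by
            rcases eq_or_ne (y j) 0 with h0 | h0
            · rw [h0, mul_zero]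
              exact mul_nonneg (hx i) (Complex.normSq_nonneg _)
            · exact (div_mul_cancel₀ _ h0).le
      _ = x i := by rw [← Finset.mul_sum, hnorm, mul_one]
  have hholder (i : n) : ∑ j, q i j * y j ^ p ≤
      ((Finset.univ.image c).card : ℝ) ^ (1 - p) * x i ^ p := by
    have h1 := Real.inner_le_weight_mul_Lp_of_nonneg Finset.univ (p := p⁻¹)
      ((one_le_inv₀ hp).mpr hp1) (q i) (fun j => y j ^ p) (hq i)
      (fun j => Real.rpow_nonneg (hy j) p)
    simp only [inv_inv, ← Real.rpow_mul (hy _), mul_inv_cancel₀ hp.ne', Real.rpow_one] at h1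
    refine h1.trans (mul_le_mul ?_ ?_ ?_ ?_)
    · exact Real.rpow_le_rpow (Finset.sum_nonneg fun j _ => hq i j) (hqsum i) (by linarith)
    · exact Real.rpow_le_rpow (Finset.sum_nonneg fun j _ => mul_nonneg (hq i j) (hy j))
        (hqy i) hp.le
    · exact Real.rpow_nonneg (Finset.sum_nonneg fun j _ => mul_nonneg (hq i j) (hy j)) _
    · positivity
  have hsplit (j : n) : y j ^ p = ∑ i, q i j * y j ^ p := by
    rw [← Finset.sum_mul, ← Finset.sum_div, ← hydef]
    rcases eq_or_ne (y j) 0 with h0 | h0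
    · rw [h0, Real.zero_rpow hp.ne', mul_zero]
    · rw [div_self h0, one_mul]
  calc ∑ j, y j ^ p = ∑ i, ∑ j, q i j * y j ^ p := by
        rw [Finset.sum_comm]
        exact Finset.sum_congr rfl fun j _ => hsplit j
    _ ≤ ∑ i, ((Finset.univ.image c).card : ℝ) ^ (1 - p) * x i ^ p :=
        Finset.sum_le_sum fun i _ => hholder i
    _ = _ := by rw [Finset.mul_sum]

/-- The projector bound for an arbitrary positive semidefinite `σ`. -/
lemma mul_trace_posProj_pinch_le {ρ σ : Matrix n n ℂ} (hρ : ρ.PosSemidef) (hσ : σ.PosSemidef)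
    {c α : ℝ} (hc : 0 < c) (hα : α ∈ Set.Ioo (0 : ℝ) 1) :
    c * (posProj (pinch σ ρ - (c : ℂ) • σ) * σ).trace.re ≤
      (nEig σ : ℝ) ^ α * c ^ α *
        (matPow (matPow σ (α / (2 * (1 - α))) * ρ *
          matPow σ (α / (2 * (1 - α)))) (1 - α)).trace.re := by
  obtain ⟨hα0, hα1⟩ := hα
  have hp : 0 < 1 - α := by linarith
  set β := α / (2 * (1 - α)) with hβdef
  have hβ : 0 < β := by positivity
  have hM : (pinch σ ρ - (c : ℂ) • σ).IsHermitian := by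
    refine (isHermitian_pinch σ hρ.1).sub ?_
    rw [IsHermitian, conjTranspose_smul, hσ.1.eq, Complex.star_def, Complex.conj_ofReal]
  have hcomm : Commute σ (pinch σ ρ - (c : ℂ) • σ) :=
    (commute_pinch hσ.1 ρ).sub_right ((Commute.refl σ).smul_right _)
  obtain ⟨U, hU, s, m, hs, hm⟩ := hσ.1.exists_unitary_of_commute hM hcomm
  have hUU : star U * U = 1 := mem_unitaryGroup_iff'.mp hU
  have hdiag (d : n → ℂ) : star U * (U * diagonal d * star U) * U = diagonal d := by
    calc _ = (star U * U) * diagonal d * (star U * U) := by simp only [mul_assoc]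
      _ = _ := by rw [hUU, one_mul, mul_one]
  have hs0 (j : n) : 0 ≤ s j := by
    have h1 := (hσ.conjTranspose_mul_mul_same U).diag_nonneg (i := j)
    rw [← star_eq_conjTranspose, hs, hdiag, diagonal_apply_eq] at h1
    exact_mod_cast h1
  let e (j : n) : ℝ := m j + c * s j
  have hentry (j k : n) (hjk : s j = s k) :
      (star U * ρ * U) j k = if j = k then (e j : ℂ) else 0 := by
    have h1 : star U * pinch σ ρ * U =
        diagonal (fun i => (m i : ℂ)) + (c : ℂ) • diagonal (fun i => (s i : ℂ)) := by
      rw [← hdiag (fun i => (m i : ℂ)), ← hm, ← hdiag (fun i => (s i : ℂ)), ← hs]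
      rw [mul_sub, sub_mul, Matrix.mul_smul, Matrix.smul_mul, sub_add_cancel]
    have h2 := star_mul_pinch_mul (a := s) hU ρ j k
    rw [← hs, if_pos hjk, h1] at h2
    rw [← h2, Matrix.add_apply, Matrix.smul_apply, diagonal_apply, diagonal_apply]
    split_ifs <;> simp [e]
  have he0 (j : n) : 0 ≤ e j := by
    have h1 := (hρ.conjTranspose_mul_mul_same U).diag_nonneg (i := j)
    rw [← star_eq_conjTranspose, hentry j j rfl, if_pos rfl] at h1
    exact_mod_cast h1
  have hpow : matPow σ β = U * diagonal (fun i => ((s i ^ β : ℝ) : ℂ)) * star U := by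
    conv_lhs => rw [hs]
    rw [matPow_conj_diagonal hU]
    simp only [rpow0_eq_rpow hβ]
  set X := matPow σ β * ρ * matPow σ β with hXdef
  have hX : X.PosSemidef := by
    have hH : (matPow σ β)ᴴ = matPow σ β := by
      rw [hpow]; exact isHermitian_conj_diagonal
    have := hρ.mul_mul_conjTranspose_same (matPow σ β)
    rwa [hH] at this
  let V : Matrix n n ℂ := (hX.1.eigenvectorUnitary : Matrix n n ℂ)
  have hV : V ∈ unitaryGroup n ℂ := hX.1.eigenvectorUnitary.2
  let x := hX.1.eigenvalues
  have hXV : X = V * diagonal (fun i => (x i : ℂ)) * star V := hX.1.eq_conj_diagonal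
  have htr : (matPow X (1 - α)).trace.re = ∑ i, x i ^ (1 - α) := by
    conv_lhs => rw [hXV]
    rw [matPow_conj_diagonal hV, trace_conj_diagonal hV, ← Complex.ofReal_sum, Complex.ofReal_re]
    simp only [rpow0_eq_rpow hp]
  let y (j : n) : ℝ := s j ^ β * e j * s j ^ β
  have hW : star U * V ∈ unitaryGroup n ℂ := mul_mem (Unitary.star_mem hU) hV
  have hXU : (star U * V) * diagonal (fun i => (x i : ℂ)) * star (star U * V) =
      diagonal (fun i => ((s i ^ β : ℝ) : ℂ)) * (star U * ρ * U) *
        diagonal (fun i => ((s i ^ β : ℝ) : ℂ)) := by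
    calc _ = star U * X * U := by rw [hXV, star_mul, star_star]; simp only [mul_assoc]
      _ = (star U * U) * diagonal (fun i => ((s i ^ β : ℝ) : ℂ)) * (star U * ρ * U) *
          diagonal (fun i => ((s i ^ β : ℝ) : ℂ)) * (star U * U) := by
        rw [hXdef, hpow]; simp only [mul_assoc]
      _ = _ := by rw [hUU, one_mul, mul_one]
  have hsum := sum_rpow_le_card_rpow_mul_sum_rpow (y := y) (c := s) hW hX.eigenvalues_nonneg
    (fun j k hjk => by
      have h1 := congrFun (congrFun hXU j) k
      rw [mul_diagonal, diagonal_mul, hentry j k hjk, mul_apply] at h1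
      simp only [mul_diagonal, star_apply] at h1
      rw [h1]
      split_ifs with hjk'
      · subst hjk'; simp [y]
      · simp) hp (by linarith)
  have htrσ : (posProj (pinch σ ρ - (c : ℂ) • σ) * σ).trace.re =
      ∑ j, if 0 ≤ m j then s j else 0 := by
    rw [hm, posProj_conj_diagonal hU]
    conv_lhs => rw [hs]
    have : U * diagonal (fun i => if 0 ≤ m i then (1 : ℂ) else 0) * star U *
        (U * diagonal (fun i => (s i : ℂ)) * star U) =
        U * diagonal (fun i => (((if 0 ≤ m i then s i else 0 : ℝ)) : ℂ)) * star U := by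
      calc _ = U * (diagonal (fun i => if 0 ≤ m i then (1 : ℂ) else 0) * (star U * U) *
            diagonal (fun i => (s i : ℂ))) * star U := by simp only [mul_assoc]
        _ = _ := by
          rw [hUU, mul_one, diagonal_mul_diagonal]
          congr 3
          ext i
          split_ifs <;> simp
    rw [this, trace_conj_diagonal hU, ← Complex.ofReal_sum, Complex.ofReal_re]
  have hterm (j : n) : c * (if 0 ≤ m j then s j else 0) ≤ c ^ α * y j ^ (1 - α) := by
    have hy0 : 0 ≤ y j :=
      mul_nonneg (mul_nonneg (Real.rpow_nonneg (hs0 j) _) (he0 j)) (Real.rpow_nonneg (hs0 j) _)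
    split_ifs with hmj
    · rcases (hs0 j).eq_or_lt with h0 | h0
      · rw [← h0, mul_zero]; positivity
      have hy : y j ^ (1 - α) = s j ^ α * e j ^ (1 - α) := by
        have h1 : y j = s j ^ (2 * β) * e j := by
          rw [two_mul, Real.rpow_add h0]; ring
        rw [h1, Real.mul_rpow (Real.rpow_nonneg h0.le _) (he0 j), ← Real.rpow_mul h0.le]
        congr 2
        rw [hβdef]; field_simp
      calc c * s j = (c * s j) ^ α * (c * s j) ^ (1 - α) := by
            rw [← Real.rpow_add (mul_pos hc h0), add_sub_cancel, Real.rpow_one]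
        _ ≤ (c * s j) ^ α * e j ^ (1 - α) := by
            gcongr
            exact le_add_of_nonneg_left hmj
        _ = c ^ α * y j ^ (1 - α) := by
            rw [hy, Real.mul_rpow hc.le h0.le, mul_assoc]
    · rw [mul_zero]; positivity
  have hcard : (((Finset.univ.image s).card : ℕ) : ℝ) ≤ nEig σ := by
    have := card_image_le_nEig (a := s) hU
    rw [← hs] at this
    exact_mod_cast this
  rw [sub_sub_cancel] at hsum
  rw [htrσ, htr]
  have hxsum : 0 ≤ ∑ i, x i ^ (1 - α) :=
    Finset.sum_nonneg fun i _ => Real.rpow_nonneg (hX.eigenvalues_nonneg i) _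
  calc c * ∑ j, (if 0 ≤ m j then s j else 0)
      ≤ ∑ j, c ^ α * y j ^ (1 - α) := by
        rw [Finset.mul_sum]; exact Finset.sum_le_sum fun j _ => hterm j
    _ = c ^ α * ∑ j, y j ^ (1 - α) := by rw [Finset.mul_sum]
    _ ≤ c ^ α * ((nEig σ : ℝ) ^ α * ∑ i, x i ^ (1 - α)) := by
        refine mul_le_mul_of_nonneg_left (hsum.trans ?_) (Real.rpow_nonneg hc.le α)
        exact mul_le_mul_of_nonneg_right (Real.rpow_le_rpow (Nat.cast_nonneg _) hcard hα0.le) hxsum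
    _ = _ := by ring

end PinchedTrace


open scoped Kronecker

lemma posSemidef_of_eq_sum_submatrix {ι κ ν : Type*} [Fintype κ] {ρ : Matrix ν ν ℂ}
    (hρ : ρ.PosSemidef) {f : κ → ι → ν} {τ : Matrix ι ι ℂ}
    (hτ : ∀ a a', τ a a' = ∑ b, ρ (f b a) (f b a')) : τ.PosSemidef := by
  have : τ = ∑ b, ρ.submatrix (f b) (f b) := by
    ext a a'
    rw [hτ, Matrix.sum_apply]
    rfl
  rw [this]
  exact posSemidef_sum _ fun b _ => hρ.submatrix (f b)

/-- second projector property (Lemma 2, eq. (35)):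
`2^{R+R_S} Tr[Π σ] ≤ ν₁^α · 2^{α[R + R_S − D̃_{1−α}(ρ‖σ)]}` where `σ = ρ₁ ⊗ ρ₂` and
`Π` is the projection onto the nonnegative part of `ℰ_σ(ρ) − 2^{R+R_S} σ`. -/
theorem projector_property_two
    {ι₁ ι₂ : Type*} [Fintype ι₁] [DecidableEq ι₁] [Nonempty ι₁]
    [Fintype ι₂] [DecidableEq ι₂] [Nonempty ι₂]
    (ρ : Matrix (ι₁ × ι₂) (ι₁ × ι₂) ℂ) (hρ : IsDensityMatrix ρ)
    (ρ₁ : Matrix ι₁ ι₁ ℂ) (hρ₁ : ∀ a a', ρ₁ a a' = ∑ b : ι₂, ρ (a, b) (a', b))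
    (ρ₂ : Matrix ι₂ ι₂ ℂ) (hρ₂ : ∀ b b', ρ₂ b b' = ∑ a : ι₁, ρ (a, b) (a, b'))
    (σ : Matrix (ι₁ × ι₂) (ι₁ × ι₂) ℂ) (hσ : σ = ρ₁ ⊗ₖ ρ₂)
    (R RS α : ℝ) (hR : 0 < R) (hRS : 0 < RS) (hα : α ∈ Set.Ioo (0 : ℝ) (1/2))
    (Proj : Matrix (ι₁ × ι₂) (ι₁ × ι₂) ℂ)
    (hProj : Proj = posProj (pinch σ ρ - (((2 : ℝ) ^ (R + RS) : ℝ) : ℂ) • σ)) :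
    (2 : ℝ) ^ (R + RS) * (Proj * σ).trace.re ≤
      (nEig σ : ℝ) ^ α * (2 : ℝ) ^ (α * (R + RS)) *
        (matPow (matPow σ (α / (2 * (1 - α))) * ρ *
          matPow σ (α / (2 * (1 - α)))) (1 - α)).trace.re := by
  have hσ' : σ.PosSemidef := by
    rw [hσ]
    exact (posSemidef_of_eq_sum_submatrix (f := fun b a => (a, b)) hρ.1 hρ₁).kronecker
      (posSemidef_of_eq_sum_submatrix (f := fun a b => (a, b)) hρ.1 hρ₂)
  have h := mul_trace_posProj_pinch_le hρ.1 hσ'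
    (Real.rpow_pos_of_pos (two_pos : (0 : ℝ) < 2) (R + RS))
    ⟨hα.1, hα.2.trans (by norm_num)⟩
  rwa [← hProj, ← Real.rpow_mul two_pos.le, mul_comm (R + RS) α] at h
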